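/- Let 0 ≤ λ ≤ 1 and let η be a real with 1 − k^{λ−1} ≤ η ≤ min(1, 1 − 2/k + k^{λ−1}). Then P_ue(C,η) ≤ (|C|/k^n) · 2^{H_λ(C^⊥)}. -/

import Mathlib

open Finset

/-- Hamming weight of a vector. -/
def wtv {F : Type*} [DecidableEq F] [Zero F] {n : ℕ} (x : Fin n → F) : ℕ :=
  (Finset.univ.filter fun i => x i ≠ 0).card

/-- `wdist C i` is the number of codewords of `C` of Hamming weight `i`. -/
noncomputable def wdist {F : Type*} [Field F] [DecidableEq F] {n : ℕ}
    (C : Submodule F (Fin n → F)) (i : ℕ) : ℕ :=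
  Nat.card {x : Fin n → F // x ∈ C ∧ wtv x = i}

/-- The dual code `C^⊥ = {x : Σ_i x_i y_i = 0 for all y ∈ C}`. -/
def dualCode {F : Type*} [Field F] {n : ℕ} (C : Submodule F (Fin n → F)) :
    Submodule F (Fin n → F) where
  carrier := {x | ∀ y ∈ C, ∑ i, x i * y i = 0}
  add_mem' := by
    intro a b ha hb y hy
    simpa [add_mul, Finset.sum_add_distrib] using by rw [ha y hy, hb y hy]; ring
  zero_mem' := by intro y hy; simp
  smul_mem' := by
    intro c a ha y hy
    simp only [Set.mem_setOf_eq] at ha ⊢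
    simp [smul_eq_mul, mul_assoc, ← Finset.mul_sum, ha y hy]

/-- `C_S`: the image of the code `C` under the coordinate projection `F^n → F^S`. -/
def projCode {F : Type*} [Field F] {n : ℕ} (C : Submodule F (Fin n → F))
    (S : Finset (Fin n)) : Submodule F ({i // i ∈ S} → F) :=
  C.map (LinearMap.funLeft F F (Subtype.val : {i // i ∈ S} → Fin n))

/-- `H_λ(D) = log₂(k)·(dim D − Σ_S (1−λ)^{|S|} λ^{n−|S|} dim D_S)`, the conditional
entropy (in bits) of a uniform codeword of `D` given the output of the `k`-ary erasure
channel with erasure probability `λ`. -/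
noncomputable def condEntropyEC {F : Type*} [Field F] [Fintype F] {n : ℕ}
    (D : Submodule F (Fin n → F)) (lam : ℝ) : ℝ :=
  Real.logb 2 (Fintype.card F) *
    ((Module.finrank F D : ℝ) -
      ∑ S : Finset (Fin n),
        (1 - lam) ^ S.card * lam ^ (n - S.card) * (Module.finrank F (projCode D S) : ℝ))

/-- The probability of undetected error of `C` on the `k`-ary symmetric channel with
error probability `η`. -/
noncomputable def Pue {F : Type*} [Field F] [Fintype F] [DecidableEq F] {n : ℕ}
    (C : Submodule F (Fin n → F)) (η : ℝ) : ℝ :=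
  ∑ i ∈ Finset.Icc 1 n,
    (wdist C i : ℝ) * (η / ((Fintype.card F : ℝ) - 1)) ^ i * (1 - η) ^ (n - i)

/-- The vectors whose coordinates in `S` are zero. -/
def vanishingOn (F : Type*) [Field F] {n : ℕ} (S : Finset (Fin n)) :
    Submodule F (Fin n → F) where
  carrier := {x | ∀ i ∈ S, x i = 0}
  add_mem' := by
    intro a b ha hb i hi
    simp [ha i hi, hb i hi]
  zero_mem' := by intro i _; rfl
  smul_mem' := by
    intro c a ha i hi
    simp [ha i hi]

theorem mem_vanishingOn {F : Type*} [Field F] {n : ℕ} {S : Finset (Fin n)} {x : Fin n → F} :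
    x ∈ vanishingOn F S ↔ ∀ i ∈ S, x i = 0 := Iff.rfl

theorem mem_dualCode {F : Type*} [Field F] {n : ℕ} {C : Submodule F (Fin n → F)}
    {x : Fin n → F} : x ∈ dualCode C ↔ ∀ y ∈ C, ∑ i, x i * y i = 0 := Iff.rfl

theorem vanishingOn_insert {F : Type*} [Field F] {n : ℕ} (j : Fin n) (S : Finset (Fin n)) :
    vanishingOn F (insert j S) = vanishingOn F {j} ⊓ vanishingOn F S := by
  ext x
  simp [mem_vanishingOn]

theorem finrank_projCode_add {F : Type*} [Field F] {n : ℕ}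
    (D : Submodule F (Fin n → F)) (S : Finset (Fin n)) :
    Module.finrank F (projCode D S) +
      Module.finrank F (D ⊓ vanishingOn F S : Submodule F (Fin n → F)) =
        Module.finrank F D := by
  have h := LinearMap.finrank_range_add_finrank_ker
    ((LinearMap.funLeft F F (Subtype.val : {i // i ∈ S} → Fin n)).domRestrict D)
  rw [LinearMap.range_domRestrict] at h
  rw [← h]
  have e : (D ⊓ vanishingOn F S : Submodule F (Fin n → F)) =
      (LinearMap.ker ((LinearMap.funLeft F F
        (Subtype.val : {i // i ∈ S} → Fin n)).domRestrict D)).map D.subtype := by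
    ext x
    simp only [Submodule.mem_inf, mem_vanishingOn, Submodule.mem_map, LinearMap.mem_ker,
      funext_iff, Submodule.subtype_apply, Subtype.exists]
    constructor
    · rintro ⟨hx, h⟩
      exact ⟨x, hx, fun i => h i.1 i.2, fun _ => rfl⟩
    · rintro ⟨y, hy, h, hyx⟩
      obtain rfl : y = x := funext hyx
      exact ⟨hy, fun i hi => h ⟨i, hi⟩⟩
  rw [e, Submodule.finrank_map_subtype_eq]
  rfl

theorem finrank_vanishingOn {F : Type*} [Field F] {n : ℕ} (S : Finset (Fin n)) :
    S.card + Module.finrank F (vanishingOn F S) = n := by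
  have h := finrank_projCode_add (⊤ : Submodule F (Fin n → F)) S
  have hs : projCode (⊤ : Submodule F (Fin n → F)) S = ⊤ := by
    rw [projCode, Submodule.map_top, LinearMap.range_eq_top]
    exact LinearMap.funLeft_surjective_of_injective F F _ Subtype.val_injective
  rw [hs, top_inf_eq] at h
  simpa using h

theorem dualCode_sup {F : Type*} [Field F] {n : ℕ} (A B : Submodule F (Fin n → F)) :
    dualCode (A ⊔ B) = dualCode A ⊓ dualCode B := by
  ext x
  simp only [Submodule.mem_inf, mem_dualCode]
  constructor
  · exact fun h => ⟨fun y hy => h y (Submodule.mem_sup_left hy),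
      fun y hy => h y (Submodule.mem_sup_right hy)⟩
  · rintro ⟨h₁, h₂⟩ y hy
    obtain ⟨a, ha, b, hb, rfl⟩ := Submodule.mem_sup.1 hy
    simp [mul_add, Finset.sum_add_distrib, h₁ a ha, h₂ b hb]

theorem dualCode_vanishingOn {F : Type*} [Field F] {n : ℕ} (S : Finset (Fin n)) :
    dualCode (vanishingOn F S) = vanishingOn F Sᶜ := by
  ext x
  simp only [mem_dualCode, mem_vanishingOn, Finset.mem_compl]
  constructor
  · intro h i hi
    have := h (Pi.single i 1) fun j hj => by
      rw [Pi.single_eq_of_ne]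
      rintro rfl
      exact hi hj
    simpa [Pi.single_apply] using this
  · intro h y hy
    refine Finset.sum_eq_zero fun i _ => ?_
    by_cases hi : i ∈ S
    · simp [hy i hi]
    · simp [h i hi]

theorem finrank_dualCode {F : Type*} [Field F] {n : ℕ} (A : Submodule F (Fin n → F)) :
    Module.finrank F A + Module.finrank F (dualCode A) = n := by
  let e := dotProductEquiv F (Fin n)
  have h : dualCode A = A.dualAnnihilator.comap e.toLinearMap := by
    ext x
    simp [mem_dualCode, Submodule.mem_dualAnnihilator, e, dotProduct]
  have h2 : Module.finrank F (A.dualAnnihilator.comap e.toLinearMap) =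
      Module.finrank F A.dualAnnihilator := by
    rw [Submodule.comap_equiv_eq_map_symm]
    exact LinearEquiv.finrank_map_eq e.symm _
  rw [h, h2, Subspace.finrank_add_finrank_dualAnnihilator_eq]
  simp

theorem finrank_dualCode_inf_vanishingOn {F : Type*} [Field F] {n : ℕ}
    (C : Submodule F (Fin n → F)) (S : Finset (Fin n)) :
    Module.finrank F (C ⊓ vanishingOn F S : Submodule F (Fin n → F)) + S.card =
      Module.finrank F C +
        Module.finrank F (dualCode C ⊓ vanishingOn F Sᶜ : Submodule F (Fin n → F)) := by
  rw [← dualCode_vanishingOn, ← dualCode_sup]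
  have h₁ := finrank_dualCode (C ⊔ vanishingOn F S)
  have h₂ := Submodule.finrank_sup_add_finrank_inf_eq C (vanishingOn F S)
  have h₃ := finrank_vanishingOn (F := F) S
  omega

theorem finrank_le_finrank_inf_vanishingOn_singleton {F : Type*} [Field F] {n : ℕ}
    (D : Submodule F (Fin n → F)) (j : Fin n) :
    Module.finrank F D ≤
      Module.finrank F (D ⊓ vanishingOn F {j} : Submodule F (Fin n → F)) + 1 := by
  have h := finrank_projCode_add D {j}
  have h₂ := Submodule.finrank_le (projCode D {j})
  simp only [Module.finrank_fintype_fun_eq_card, Fintype.card_coe, card_singleton] at h₂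
  omega

open Classical in
theorem card_filter_mem_submodule {F : Type*} [Field F] [Fintype F] {n : ℕ}
    (D : Submodule F (Fin n → F)) :
    #{y | y ∈ D} = Fintype.card F ^ Module.finrank F D := by
  rw [← Module.card_eq_pow_finrank (K := F) (V := D), Fintype.card_subtype]

open Classical in
/-- Expansion of the weight enumerator of a code over its shortened subcodes. -/
theorem sum_prod_ite_eq {F : Type*} [Field F] [Fintype F] [DecidableEq F] {n : ℕ}
    (D : Submodule F (Fin n → F)) (a b : ℝ) :
    ∑ y with y ∈ D, ∏ i, (if y i = 0 then a + b else b) =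
      ∑ S : Finset (Fin n), a ^ S.card * b ^ (n - S.card) *
        (Fintype.card F : ℝ) ^
          Module.finrank F (D ⊓ vanishingOn F S : Submodule F (Fin n → F)) := by
  have h : ∀ y : Fin n → F, ∏ i, (if y i = 0 then a + b else b) =
      ∑ S : Finset (Fin n), a ^ S.card * b ^ (n - S.card) *
        (if y ∈ vanishingOn F S then 1 else 0) := by
    intro y
    have e : ∀ i, (if y i = 0 then a + b else b) = (if y i = 0 then a else 0) + b := by
      intro i
      split_ifs <;> simp
    simp_rw [e, Finset.prod_add, Finset.powerset_univ]
    refine Finset.sum_congr rfl fun S _ => ?_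
    rw [Finset.prod_const, Finset.prod_ite_zero, Finset.prod_const,
      Finset.card_sdiff_of_subset (Finset.subset_univ S), Finset.card_univ, Fintype.card_fin]
    simp only [mem_vanishingOn]
    split_ifs <;> simp
  simp_rw [h]
  rw [Finset.sum_comm]
  refine Finset.sum_congr rfl fun S _ => ?_
  rw [← Finset.mul_sum, Finset.sum_boole, Finset.filter_filter]
  congr 1
  have := card_filter_mem_submodule (D ⊓ vanishingOn F S)
  simp only [Submodule.mem_inf] at this
  exact_mod_cast this

open Classical in
/-- The MacWilliams identity. -/
theorem macWilliams_identity {F : Type*} [Field F] [Fintype F] [DecidableEq F] {n : ℕ}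
    (C : Submodule F (Fin n → F)) (p : ℝ) :
    ∑ x with x ∈ C, ∏ i, (if x i = 0 then 1 - ((Fintype.card F : ℝ) - 1) * p else p) =
      (Nat.card C : ℝ) / (Fintype.card F : ℝ) ^ n *
        ∑ y with y ∈ dualCode C, ∏ i, (if y i = 0 then 1 else 1 - (Fintype.card F : ℝ) * p) := by
  have h₁ := sum_prod_ite_eq C (1 - (Fintype.card F : ℝ) * p) p
  have h₂ := sum_prod_ite_eq (dualCode C) ((Fintype.card F : ℝ) * p)
    (1 - (Fintype.card F : ℝ) * p)
  rw [show 1 - (Fintype.card F : ℝ) * p + p = 1 - ((Fintype.card F : ℝ) - 1) * p by ring] at h₁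
  rw [add_sub_cancel] at h₂
  rw [h₁, h₂, ← (compl_bijective (α := Finset (Fin n))).sum_comp, Finset.mul_sum]
  have hk : (Fintype.card F : ℝ) ≠ 0 := by exact_mod_cast Fintype.card_ne_zero
  refine Finset.sum_congr rfl fun S _ => ?_
  have hS : S.card ≤ n := by simpa using Finset.card_le_univ S
  have hd := finrank_dualCode_inf_vanishingOn C Sᶜ
  rw [compl_compl, Finset.card_compl, Fintype.card_fin] at hd
  rw [Finset.card_compl, Fintype.card_fin, Nat.sub_sub_self hS,
    Nat.card_eq_fintype_card, Module.card_eq_pow_finrank (K := F) (V := C), mul_pow,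
    div_mul_eq_mul_div, eq_div_iff (pow_ne_zero _ hk)]
  push_cast
  have e : (Fintype.card F : ℝ) ^
        Module.finrank F (C ⊓ vanishingOn F Sᶜ : Submodule F (Fin n → F)) *
        (Fintype.card F : ℝ) ^ n =
      (Fintype.card F : ℝ) ^ Module.finrank F C * (Fintype.card F : ℝ) ^ S.card *
        (Fintype.card F : ℝ) ^
          Module.finrank F (dualCode C ⊓ vanishingOn F S : Submodule F (Fin n → F)) := by
    rw [← pow_add, ← pow_add, ← pow_add]
    congr 1
    omega
  linear_combination (1 - (Fintype.card F : ℝ) * p) ^ (n - S.card) * p ^ S.card * e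

/-- The expected dimension of the subcode of `D` vanishing on a random subset of `J`, where each
element of `J` is kept with probability `1 - lam`. -/
noncomputable def expectedShortenedDim {F : Type*} [Field F] {n : ℕ} (lam : ℝ)
    (J : Finset (Fin n)) (D : Submodule F (Fin n → F)) : ℝ :=
  ∑ S ∈ J.powerset, (1 - lam) ^ S.card * lam ^ (J.card - S.card) *
    (Module.finrank F (D ⊓ vanishingOn F S : Submodule F (Fin n → F)) : ℝ)

theorem expectedShortenedDim_insert {F : Type*} [Field F] {n : ℕ} (lam : ℝ)
    {J : Finset (Fin n)} {j : Fin n} (hj : j ∉ J) (D : Submodule F (Fin n → F)) :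
    expectedShortenedDim lam (insert j J) D =
      lam * expectedShortenedDim lam J D +
        (1 - lam) * expectedShortenedDim lam J (D ⊓ vanishingOn F {j}) := by
  unfold expectedShortenedDim
  rw [Finset.sum_powerset_insert hj, Finset.mul_sum, Finset.mul_sum]
  congr 1 <;> refine Finset.sum_congr rfl fun S hS => ?_
  · have := Finset.card_le_card (Finset.mem_powerset.1 hS)
    rw [Finset.card_insert_of_notMem hj, Nat.sub_add_comm this]
    ring
  · have hjS : j ∉ S := fun h => hj (Finset.mem_powerset.1 hS h)
    rw [Finset.card_insert_of_notMem hj, Finset.card_insert_of_notMem hjS,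
      Nat.add_sub_add_right, vanishingOn_insert, ← inf_assoc]
    ring

theorem expectedShortenedDim_mono {F : Type*} [Field F] {n : ℕ} {lam : ℝ} (h₀ : 0 ≤ lam)
    (h₁ : lam ≤ 1) (J : Finset (Fin n)) {D E : Submodule F (Fin n → F)} (h : D ≤ E) :
    expectedShortenedDim lam J D ≤ expectedShortenedDim lam J E := by
  have : 0 ≤ 1 - lam := by linarith
  refine Finset.sum_le_sum fun S _ => mul_le_mul_of_nonneg_left ?_ (by positivity)
  exact_mod_cast Submodule.finrank_mono (inf_le_inf_right _ h)

theorem expectedShortenedDim_le_add_one {F : Type*} [Field F] {n : ℕ} {lam : ℝ} (h₀ : 0 ≤ lam)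
    (h₁ : lam ≤ 1) (J : Finset (Fin n)) (D : Submodule F (Fin n → F)) (j : Fin n) :
    expectedShortenedDim lam J D ≤
      expectedShortenedDim lam J (D ⊓ vanishingOn F {j}) + 1 := by
  have h : 0 ≤ 1 - lam := by linarith
  have hs := Finset.sum_pow_mul_eq_add_pow (1 - lam) lam J
  rw [sub_add_cancel, one_pow] at hs
  rw [← hs]
  unfold expectedShortenedDim
  rw [← Finset.sum_add_distrib]
  refine Finset.sum_le_sum fun S _ => ?_
  rw [← mul_add_one]
  refine mul_le_mul_of_nonneg_left ?_ (by positivity)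
  rw [inf_right_comm]
  exact_mod_cast finrank_le_finrank_inf_vanishingOn_singleton (D ⊓ vanishingOn F S) j

/-- The power function lies above its chord on `[1, k]`. -/
theorem one_sub_add_mul_le_rpow {k lam t : ℝ} (hk : 1 < k) (h₀ : 0 ≤ lam) (h₁ : lam ≤ 1)
    (ht : 1 ≤ t) (htk : t ≤ k) :
    1 - (k ^ lam - 1) / (k - 1) + (k ^ lam - 1) / (k - 1) * t ≤ t ^ lam := by
  have hk' : 0 < k - 1 := by linarith
  have hab : (k - t) / (k - 1) + (t - 1) / (k - 1) = 1 := by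
    field_simp
    ring
  have hc := (Real.concaveOn_rpow h₀ h₁).2 (Set.mem_Ici.2 zero_le_one)
    (Set.mem_Ici.2 (zero_le_one.trans hk.le))
    (div_nonneg (sub_nonneg.2 htk) hk'.le) (div_nonneg (sub_nonneg.2 ht) hk'.le) hab
  have e : (k - t) / (k - 1) * 1 + (t - 1) / (k - 1) * k = t := by
    field_simp
    ring
  simp only [smul_eq_mul, Real.one_rpow, e] at hc
  refine le_of_eq_of_le ?_ hc
  field_simp
  ring

open Classical in
theorem sum_prod_ite_le_rpow {F : Type*} [Field F] [Fintype F] [DecidableEq F] {n : ℕ} {lam : ℝ}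
    (h₀ : 0 ≤ lam) (h₁ : lam ≤ 1) (J : Finset (Fin n)) (D : Submodule F (Fin n → F)) :
    ∑ y with y ∈ D, ∏ i ∈ J, (if y i = 0 then 1 else
        ((Fintype.card F : ℝ) ^ lam - 1) / ((Fintype.card F : ℝ) - 1)) ≤
      (Fintype.card F : ℝ) ^ expectedShortenedDim lam J D := by
  set k : ℝ := (Fintype.card F : ℝ) with hkdef
  have hk : 1 < k := Nat.one_lt_cast.2 Fintype.one_lt_card
  have hk0 : 0 < k := by linarith
  set θ := (k ^ lam - 1) / (k - 1) with hθ
  have hθ0 : 0 ≤ θ :=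
    div_nonneg (sub_nonneg.2 (Real.one_le_rpow hk.le h₀)) (by linarith)
  have hθ1 : θ ≤ 1 := by
    rw [hθ, div_le_one (by linarith)]
    have := Real.rpow_le_rpow_of_exponent_le hk.le h₁
    rw [Real.rpow_one] at this
    linarith
  induction J using Finset.induction_on generalizing D with
  | empty =>
    simp only [Finset.prod_empty, Finset.sum_const, nsmul_eq_mul, mul_one,
      card_filter_mem_submodule]
    have : D ⊓ vanishingOn F (∅ : Finset (Fin n)) = D := by
      ext
      simp [mem_vanishingOn]
    rw [expectedShortenedDim, Finset.powerset_empty, Finset.sum_singleton, this]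
    simp [hkdef]
  | insert j J hj ih =>
    set D' := D ⊓ vanishingOn F {j} with hD'
    have hsplit : ∑ y with y ∈ D, ∏ i ∈ insert j J, (if y i = 0 then 1 else θ) =
        (1 - θ) * ∑ y with y ∈ D', ∏ i ∈ J, (if y i = 0 then 1 else θ) +
          θ * ∑ y with y ∈ D, ∏ i ∈ J, (if y i = 0 then 1 else θ) := by
      have hf : (Finset.univ.filter fun y => y ∈ D') =
          (Finset.univ.filter fun y => y ∈ D).filter fun y => y j = 0 := by
        ext y
        simp [hD', mem_vanishingOn]
      rw [hf, Finset.sum_filter (fun y : Fin n → F => y j = 0), Finset.mul_sum, Finset.mul_sum,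
        ← Finset.sum_add_distrib]
      refine Finset.sum_congr rfl fun y _ => ?_
      rw [Finset.prod_insert hj]
      split_ifs <;> ring
    rw [hsplit, expectedShortenedDim_insert lam hj]
    set A := expectedShortenedDim lam J D'
    set B := expectedShortenedDim lam J D
    have hAB : A ≤ B := expectedShortenedDim_mono h₀ h₁ J inf_le_left
    have hBA : B ≤ A + 1 := expectedShortenedDim_le_add_one h₀ h₁ J D j
    have hchord := one_sub_add_mul_le_rpow (t := k ^ (B - A)) hk h₀ h₁
      (Real.one_le_rpow hk.le (by linarith))
      (by simpa using Real.rpow_le_rpow_of_exponent_le hk.le (show B - A ≤ 1 by linarith))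
    calc _ ≤ (1 - θ) * k ^ A + θ * k ^ B :=
          add_le_add (mul_le_mul_of_nonneg_left (ih D') (by linarith))
            (mul_le_mul_of_nonneg_left (ih D) hθ0)
      _ = k ^ A * (1 - θ + θ * k ^ (B - A)) := by
          have : k ^ B = k ^ A * k ^ (B - A) := by
            rw [← Real.rpow_add hk0, add_sub_cancel]
          rw [this]
          ring
      _ ≤ k ^ A * (k ^ (B - A)) ^ lam := by gcongr
      _ = k ^ (lam * B + (1 - lam) * A) := by
          rw [← Real.rpow_mul hk0.le, ← Real.rpow_add hk0]
          congr 1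
          ring

theorem two_rpow_condEntropyEC {F : Type*} [Field F] [Fintype F] {n : ℕ}
    (D : Submodule F (Fin n → F)) (lam : ℝ) :
    (2 : ℝ) ^ condEntropyEC D lam =
      (Fintype.card F : ℝ) ^ expectedShortenedDim lam Finset.univ D := by
  have hk : (0 : ℝ) < Fintype.card F := by exact_mod_cast Fintype.card_pos
  rw [condEntropyEC, Real.rpow_mul two_pos.le, Real.rpow_logb two_pos (by norm_num) hk]
  congr 1
  have hs := Finset.sum_pow_mul_eq_add_pow (1 - lam) lam (Finset.univ : Finset (Fin n))
  rw [sub_add_cancel, one_pow, Finset.powerset_univ, Finset.card_univ, Fintype.card_fin] at hs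
  rw [expectedShortenedDim, Finset.powerset_univ, Finset.card_univ, Fintype.card_fin]
  have hD : (Module.finrank F D : ℝ) = ∑ S : Finset (Fin n),
      (1 - lam) ^ S.card * lam ^ (n - S.card) * (Module.finrank F D : ℝ) := by
    rw [← Finset.sum_mul, hs, one_mul]
  rw [hD, ← Finset.sum_sub_distrib]
  refine Finset.sum_congr rfl fun S _ => ?_
  rw [← finrank_projCode_add D S]
  push_cast
  ring

theorem prod_ite_eq_pow_wtv {F : Type*} [Field F] [DecidableEq F] {n : ℕ} (x : Fin n → F)
    (a b : ℝ) : ∏ i, (if x i = 0 then a else b) = b ^ wtv x * a ^ (n - wtv x) := by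
  have h := Finset.card_filter_add_card_filter_not (s := (Finset.univ : Finset (Fin n)))
    (fun i => x i = 0)
  rw [Finset.card_univ, Fintype.card_fin] at h
  rw [Finset.prod_ite, Finset.prod_const, Finset.prod_const, mul_comm]
  congr 2
  unfold wtv
  simp only [ne_eq]
  omega

open Classical in
theorem Pue_add_pow {F : Type*} [Field F] [Fintype F] [DecidableEq F] {n : ℕ}
    (C : Submodule F (Fin n → F)) (η : ℝ) :
    Pue C η + (1 - η) ^ n =
      ∑ x with x ∈ C, ∏ i, (if x i = 0 then 1 - η else η / ((Fintype.card F : ℝ) - 1)) := by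
  have hmaps : ∀ x ∈ (Finset.univ.filter fun x => x ∈ C), wtv x ∈ Finset.range (n + 1) := by
    intro x _
    rw [Finset.mem_range, Nat.lt_succ_iff]
    exact (Finset.card_le_univ _).trans_eq (Fintype.card_fin n)
  rw [← Finset.sum_fiberwise_of_maps_to hmaps]
  have hterm : ∀ i, ∑ x ∈ (Finset.univ.filter fun x => x ∈ C) with wtv x = i,
      ∏ l, (if x l = 0 then 1 - η else η / ((Fintype.card F : ℝ) - 1)) =
        (wdist C i : ℝ) * (η / ((Fintype.card F : ℝ) - 1)) ^ i * (1 - η) ^ (n - i) := by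
    intro i
    rw [Finset.sum_congr rfl (g := fun _ =>
      (η / ((Fintype.card F : ℝ) - 1)) ^ i * (1 - η) ^ (n - i))]
    · rw [Finset.sum_const, nsmul_eq_mul, Finset.filter_filter, mul_assoc, wdist,
        Nat.card_eq_fintype_card, Fintype.card_subtype]
    · intro x hx
      rw [prod_ite_eq_pow_wtv, (Finset.mem_filter.1 hx).2]
  have h0 : wdist C 0 = 1 := by
    have : ∀ x : Fin n → F, x ∈ C ∧ wtv x = 0 ↔ x = 0 := by
      intro x
      constructor
      · rintro ⟨-, h⟩
        ext i
        have := Finset.filter_eq_empty_iff.1 (Finset.card_eq_zero.1 h) (Finset.mem_univ i)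
        simpa using this
      · rintro rfl
        simp [wtv]
    simp [wdist, this]
  simp_rw [hterm]
  rw [Finset.sum_range_succ', h0, Pue, Finset.range_eq_Ico,
    Finset.sum_Ico_add' (fun i => (wdist C i : ℝ) * (η / ((Fintype.card F : ℝ) - 1)) ^ i *
      (1 - η) ^ (n - i)) 0 n 1, zero_add]
  simp [Finset.Ico_add_one_right_eq_Icc]

theorem stmt19 {F : Type*} [Field F] [Fintype F] [DecidableEq F] {n : ℕ} (hn : 1 ≤ n)
    (k : ℕ) (hk : Fintype.card F = k)
    (C : Submodule F (Fin n → F)) (lam η : ℝ) (hlam0 : 0 ≤ lam) (hlam1 : lam ≤ 1)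
    (hη1 : 1 - (k : ℝ) ^ (lam - 1) ≤ η)
    (hη2 : η ≤ min 1 (1 - 2 / (k : ℝ) + (k : ℝ) ^ (lam - 1))) :
    Pue C η ≤ ((Nat.card C : ℝ) / (k : ℝ) ^ n) * (2 : ℝ) ^ condEntropyEC (dualCode C) lam := by
  classical
  subst hk
  obtain ⟨hη, hη2⟩ := le_min_iff.1 hη2
  have hk : (1 : ℝ) < Fintype.card F := by exact_mod_cast Fintype.one_lt_card
  set k : ℝ := (Fintype.card F : ℝ) with hkdef
  have hk0 : 0 < k := by linarith
  have hk1 : 0 < k - 1 := by linarith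
  set p := η / (k - 1) with hp
  have hpη : (k - 1) * p = η := by
    rw [hp]
    field_simp
  have hpow : k ^ (lam - 1) = k ^ lam / k := by rw [Real.rpow_sub hk0, Real.rpow_one]
  rw [hpow] at hη1 hη2
  set θ := (k ^ lam - 1) / (k - 1) with hθ
  have hθk : (k - 1) * θ = k ^ lam - 1 := by
    rw [hθ]
    field_simp
  have hbound : |1 - k * p| ≤ θ := by
    have e₁ : k * (1 - k ^ lam / k) ≤ k * η := mul_le_mul_of_nonneg_left hη1 hk0.le
    have e₂ : k * η ≤ k * (1 - 2 / k + k ^ lam / k) := mul_le_mul_of_nonneg_left hη2 hk0.le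
    have e₃ : k * (1 - k ^ lam / k) = k - k ^ lam := by field_simp
    have e₄ : k * (1 - 2 / k + k ^ lam / k) = k - 2 + k ^ lam := by field_simp
    rw [abs_le]
    constructor <;> refine le_of_mul_le_mul_left ?_ hk1 <;> nlinarith
  have hmw := macWilliams_identity C p
  rw [← hkdef, hpη, hp, hkdef, ← Pue_add_pow, ← hkdef, ← hp] at hmw
  rw [two_rpow_condEntropyEC]
  have hle : ∑ y with y ∈ dualCode C, ∏ i, (if y i = 0 then 1 else 1 - k * p) ≤
      k ^ expectedShortenedDim lam Finset.univ (dualCode C) := by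
    refine le_trans (Finset.sum_le_sum fun y _ => ?_)
      (sum_prod_ite_le_rpow hlam0 hlam1 Finset.univ (dualCode C))
    refine (le_abs_self _).trans ?_
    rw [Finset.abs_prod]
    refine Finset.prod_le_prod (fun _ _ => abs_nonneg _) fun i _ => ?_
    split_ifs
    · simp
    · exact hbound
  have hpos : 0 ≤ (1 - η) ^ n := pow_nonneg (by linarith) n
  calc Pue C η ≤ Pue C η + (1 - η) ^ n := by linarith
    _ ≤ _ := by
      rw [hmw]
      exact mul_le_mul_of_nonneg_left hle (by positivity)
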